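/- Let G be a 2-acyclic Cayley group with generator set E, let v_1 ≠ v_{ℓ+1} be vertices with ℓ ≥ 1, let γ ⊆ E, and set t = ρ(v_{ℓ+1}, γ). Suppose v_1, v_2, …, v_{ℓ+1} ∈ G and α_1, …, α_ℓ ⊆ E are such that the sequence of dual-hypergraph vertices (∅, [v_1]_∅), (α_1, [v_2]_{α_1}), (α_2, [v_3]_{α_2}), …, (α_ℓ, [v_{ℓ+1}]_{α_ℓ}), (∅, [v_{ℓ+1}]_∅) is a chordless path of length ℓ+1 in the Gaifman graph of d(G) restricted to d(V) \ t, where consecutive vertices are joined via the hyperedges ⟦v_1⟧, ⟦v_2⟧, …, ⟦v_{ℓ+1}⟧ respectively (i.e. v_i ∈ [v_{i+1}]_{α_i} for 1 ≤ i ≤ ℓ), all listed vertices are pairwise distinct and none lies in t, and no hyperedge ⟦w⟧ (w ∈ G) contains two vertices of the path that are not consecutive on it. Then v_1, α_1, v_2, α_2, …, v_ℓ, α_ℓ, v_{ℓ+1} is a non-t coset path of length ℓ in G. -/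

import Mathlib

open scoped Pointwise

section CayleyDefs

variable {G : Type*} [Group G]

/-- The `α`-coset of `v`, i.e. `v · ⟨α⟩` where `⟨α⟩` is the subgroup generated by `α`. -/
def coset (v : G) (α : Set G) : Set G := {x | v⁻¹ * x ∈ Subgroup.closure α}

/-- `G` together with the generator set `E` is a Cayley group: every element of `E`
is a non-trivial involution and `E` generates `G`. -/
def IsCayley (E : Set G) : Prop :=
  (∀ e ∈ E, e ≠ 1 ∧ e * e = 1) ∧ Subgroup.closure E = ⊤

/-- A coset cycle of length `m` in the Cayley group `G` with generator set `E`. -/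
def IsCosetCycle (E : Set G) (m : ℕ) (v : ZMod m → G) (α : ZMod m → Set G) : Prop :=
  (∀ i, α i ⊆ E) ∧
  (∀ i, (v i)⁻¹ * v (i + 1) ∈ Subgroup.closure (α i)) ∧
  (∀ i, coset (v i) (α (i - 1) ∩ α i) ∩ coset (v (i + 1)) (α i ∩ α (i + 1)) = ∅)

/-- Coset `n`-acyclic: no coset cycle of length `≤ n`. -/
def CosetAcyclic (E : Set G) (n : ℕ) : Prop :=
  ∀ m, 1 ≤ m → m ≤ n → ∀ (v : ZMod m → G) (α : ZMod m → Set G), ¬ IsCosetCycle E m v α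

/-- 2-acyclic: no coset cycle of length 2. -/
def TwoAcyclic (E : Set G) : Prop :=
  ∀ (v : ZMod 2 → G) (α : ZMod 2 → Set G), ¬ IsCosetCycle E 2 v α

/-- Labels of a path of length `ℓ`, where labels with indices outside `1..ℓ` equal `∅`. -/
def extLabel (ℓ : ℕ) (α : ℕ → Set G) (i : ℕ) : Set G :=
  if 1 ≤ i ∧ i ≤ ℓ then α i else ∅

/-- A coset path of length `ℓ ≥ 1` with vertices `v 1, …, v (ℓ+1)` and labels
`α 1, …, α ℓ` (vertices pairwise distinct except possibly `v 1 = v (ℓ+1)`;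
convention `α 0 = α (ℓ+1) = ∅`). -/
def IsCosetPath (E : Set G) (ℓ : ℕ) (v : ℕ → G) (α : ℕ → Set G) : Prop :=
  1 ≤ ℓ ∧
  (∀ i, 1 ≤ i → i ≤ ℓ → α i ⊆ E) ∧
  (∀ i j, 1 ≤ i → i < j → j ≤ ℓ + 1 → v i = v j → i = 1 ∧ j = ℓ + 1) ∧
  (∀ i, 1 ≤ i → i ≤ ℓ → (v i)⁻¹ * v (i + 1) ∈ Subgroup.closure (α i)) ∧
  (∀ i, 1 ≤ i → i ≤ ℓ →
    coset (v i) (extLabel ℓ α (i - 1) ∩ α i) ∩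
      coset (v (i + 1)) (α i ∩ extLabel ℓ α (i + 1)) = ∅)

/-- `γ` is the unique minimal generator set connecting `v` and `u`:
for every `β ⊆ E`, `u ∈ [v]_β` iff `γ ⊆ β`. -/
def IsGen (E : Set G) (v u : G) (γ : Set G) : Prop :=
  γ ⊆ E ∧ ∀ β ⊆ E, (u ∈ coset v β ↔ γ ⊆ β)

/-- The dual hyperedge `⟦v⟧`: all label-tagged cosets `(α, [v]_α)` for `α ⊆ E`. -/
def dedge (E : Set G) (v : G) : Set (Set G × Set G) :=
  {p | p.1 ⊆ E ∧ p.2 = coset v p.1}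

/-- The vertex set of the dual hypergraph: all label-tagged cosets. -/
def dualV (E : Set G) : Set (Set G × Set G) :=
  {p | p.1 ⊆ E ∧ ∃ v : G, p.2 = coset v p.1}

/-- Gaifman adjacency in the dual hypergraph: two distinct vertices lying in a
common hyperedge. -/
def dAdj (E : Set G) (x y : Set G × Set G) : Prop :=
  x ≠ y ∧ ∃ w : G, x ∈ dedge E w ∧ y ∈ dedge E w

/-- `ρ(v,γ) = { (β, [v]_β) : γ ⊆ β ⊆ E }`. -/
def rho (E : Set G) (v : G) (γ : Set G) : Set (Set G × Set G) :=
  {p | γ ⊆ p.1 ∧ p.1 ⊆ E ∧ p.2 = coset v p.1}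

/-- A non-`t` coset path for `t = ρ(w,γ)`: a coset path all of whose links `[v_i]_{α_i}`
fail to contain `[w]_γ`. -/
def IsNonTPath (E : Set G) (w : G) (γ : Set G) (ℓ : ℕ) (v : ℕ → G) (α : ℕ → Set G) : Prop :=
  IsCosetPath E ℓ v α ∧ ∀ i, 1 ≤ i → i ≤ ℓ → ¬ coset w γ ⊆ coset (v i) (α i)

/-- An inner coset path with respect to `g = gen(v 1, v (ℓ+1))`. -/
def IsInnerPath (E : Set G) (g : Set G) (ℓ : ℕ) (v : ℕ → G) (α : ℕ → Set G) : Prop :=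
  IsCosetPath E ℓ v α ∧ 2 ≤ ℓ ∧
    ∀ i, 1 ≤ i → i ≤ ℓ → coset (v i) (α i) ⊂ coset (v 1) g

/-- A non-trivial coset path with respect to `g = gen(v 1, v (ℓ+1))`. -/
def IsNontrivialPath (E : Set G) (g : Set G) (ℓ : ℕ) (v : ℕ → G) (α : ℕ → Set G) : Prop :=
  IsCosetPath E ℓ v α ∧ 2 ≤ ℓ ∧
    ∀ i, 1 ≤ i → i ≤ ℓ → ¬ coset (v 1) g ⊆ coset (v i) (α i)

/-- `n`-conformality of the dual hypergraph: every Gaifman clique of size `≤ n`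
is contained in a hyperedge. -/
def NConformal (E : Set G) (n : ℕ) : Prop :=
  ∀ K : Finset (Set G × Set G), K.card ≤ n → (↑K : Set (Set G × Set G)) ⊆ dualV E →
    (∀ x ∈ K, ∀ y ∈ K, x ≠ y → dAdj E x y) → ∃ w : G, ∀ x ∈ K, x ∈ dedge E w

/-- `n`-chordality of the dual hypergraph: every Gaifman cycle of length `> 3`
and `≤ n` has a chord. -/
def NChordal (E : Set G) (n : ℕ) : Prop :=
  ∀ m, 4 ≤ m → m ≤ n → ∀ c : ZMod m → Set G × Set G, Function.Injective c →
    (∀ i, c i ∈ dualV E) → (∀ i, dAdj E (c i) (c (i + 1))) →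
    ∃ i j : ZMod m, i ≠ j ∧ j ≠ i + 1 ∧ i ≠ j + 1 ∧ dAdj E (c i) (c j)

/-- A walk of length `k` in the Gaifman graph of the dual hypergraph restricted to
the complement of `t = ρ(v,γ)`, from a vertex of `⟦v⟧ \ t` to a vertex of `⟦u⟧ \ t`. -/
def HWalk (E : Set G) (v : G) (γ : Set G) (u : G) (k : ℕ) (c : ℕ → Set G × Set G) : Prop :=
  c 0 ∈ dedge E v ∧ c k ∈ dedge E u ∧
  (∀ i ≤ k, c i ∈ dualV E ∧ c i ∉ rho E v γ) ∧
  ∀ i < k, dAdj E (c i) (c (i + 1))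

/-- The sequence of dual-hypergraph vertices induced by a coset path:
`(∅,[v 1]_∅), (α 1, [v 2]_{α 1}), …, (α ℓ, [v (ℓ+1)]_{α ℓ}), (∅, [v (ℓ+1)]_∅)`. -/
def pathVert (ℓ : ℕ) (v : ℕ → G) (α : ℕ → Set G) (i : ℕ) : Set G × Set G :=
  if i = 0 then (∅, coset (v 1) ∅)
  else if i ≤ ℓ then (α i, coset (v (i + 1)) (α i))
  else (∅, coset (v (ℓ + 1)) ∅)

end CayleyDefs


theorem extLabel_of_mem {G : Type*} {ℓ : ℕ} {α : ℕ → Set G} {i : ℕ} (h1 : 1 ≤ i) (h : i ≤ ℓ) :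
    extLabel ℓ α i = α i :=
  if_pos ⟨h1, h⟩

theorem extLabel_subset {G : Type*} {E : Set G} {ℓ : ℕ} {α : ℕ → Set G}
    (hα : ∀ i, 1 ≤ i → i ≤ ℓ → α i ⊆ E) (i : ℕ) : extLabel ℓ α i ⊆ E := by
  unfold extLabel
  split_ifs with h
  · exact hα i h.1 h.2
  · exact Set.empty_subset E

section CosetLemmas

variable {G : Type*} [Group G]

theorem mem_coset_self (v : G) (α : Set G) : v ∈ coset v α := by
  simp [coset]

theorem mem_coset_comm {v x : G} {α : Set G} : x ∈ coset v α ↔ v ∈ coset x α := by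
  change v⁻¹ * x ∈ Subgroup.closure α ↔ x⁻¹ * v ∈ Subgroup.closure α
  rw [← inv_mem_iff, mul_inv_rev, inv_inv]

theorem coset_eq_of_mem {v x : G} {α : Set G} (h : x ∈ coset v α) : coset v α = coset x α := by
  ext y
  change v⁻¹ * y ∈ Subgroup.closure α ↔ x⁻¹ * y ∈ Subgroup.closure α
  rw [← Subgroup.mul_mem_cancel_left (Subgroup.closure α) (y := x⁻¹ * y) h]
  group

theorem coset_mono (v : G) {α β : Set G} (h : α ⊆ β) : coset v α ⊆ coset v β :=
  fun _ hx => Subgroup.closure_mono h hx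

theorem coset_empty (v : G) : coset v ∅ = {v} := by
  ext x
  simp [coset, inv_mul_eq_one, eq_comm]

/-- In a 2-acyclic Cayley group, a generator lies in `⟨α⟩` only if it belongs to `α`. -/
theorem TwoAcyclic.mem_of_mem_closure {E : Set G} (h2 : TwoAcyclic E) {e : G} (he : e ∈ E)
    (he1 : e ≠ 1) {α : Set G} (hα : α ⊆ E) (h : e ∈ Subgroup.closure α) : e ∈ α := by
  by_contra hn
  have h01 : ({e} : Set G) ∩ α = ∅ := Set.singleton_inter_eq_empty.mpr hn
  have h10 : α ∩ {e} = ∅ := Set.inter_singleton_eq_empty.mpr hn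
  refine h2 ![1, e] ![{e}, α] ⟨?_, ?_, ?_⟩ <;> refine Fin.forall_fin_two.mpr ⟨?_, ?_⟩
  · simpa using he
  · simpa using hα
  · change (1 : G)⁻¹ * e ∈ Subgroup.closure {e}
    simp
  · change e⁻¹ * 1 ∈ Subgroup.closure α
    simpa using h
  · change coset 1 (α ∩ {e}) ∩ coset e ({e} ∩ α) = ∅
    simpa [h01, h10, coset_empty] using he1
  · change coset e ({e} ∩ α) ∩ coset 1 (α ∩ {e}) = ∅
    simpa [h01, h10, coset_empty] using he1.symm

variable {E : Set G} {ℓ : ℕ} {v : ℕ → G} {α : ℕ → Set G}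

theorem pathVert_eq_next {i : ℕ} (hi : i ≤ ℓ) :
    pathVert ℓ v α i = (extLabel ℓ α i, coset (v (i + 1)) (extLabel ℓ α i)) := by
  rcases Nat.eq_zero_or_pos i with rfl | h0
  · simp [pathVert, extLabel]
  · rw [extLabel_of_mem h0 hi, pathVert, if_neg h0.ne', if_pos hi]

theorem pathVert_eq (hjoin : ∀ i, 1 ≤ i → i ≤ ℓ → v i ∈ coset (v (i + 1)) (α i)) {i : ℕ}
    (h1 : 1 ≤ i) (hi : i ≤ ℓ + 1) :
    pathVert ℓ v α i = (extLabel ℓ α i, coset (v i) (extLabel ℓ α i)) := by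
  rcases Nat.lt_or_ge ℓ i with h | h
  · obtain rfl : i = ℓ + 1 := by omega
    simp [pathVert, extLabel]
  · rw [pathVert_eq_next h, extLabel_of_mem h1 h, coset_eq_of_mem (hjoin i h1 h)]

theorem pathVert_mem_dedge_of_mem_next (hα : ∀ i, 1 ≤ i → i ≤ ℓ → α i ⊆ E) {i : ℕ} (hi : i ≤ ℓ)
    {w : G} (hw : w ∈ coset (v (i + 1)) (extLabel ℓ α i)) : pathVert ℓ v α i ∈ dedge E w := by
  rw [pathVert_eq_next hi]
  exact ⟨extLabel_subset hα i, coset_eq_of_mem hw⟩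

theorem pathVert_mem_dedge_of_mem (hα : ∀ i, 1 ≤ i → i ≤ ℓ → α i ⊆ E)
    (hjoin : ∀ i, 1 ≤ i → i ≤ ℓ → v i ∈ coset (v (i + 1)) (α i)) {i : ℕ}
    (h1 : 1 ≤ i) (hi : i ≤ ℓ + 1) {w : G} (hw : w ∈ coset (v i) (extLabel ℓ α i)) :
    pathVert ℓ v α i ∈ dedge E w := by
  rw [pathVert_eq hjoin h1 hi]
  exact ⟨extLabel_subset hα i, coset_eq_of_mem hw⟩

end CosetLemmas

/-- in a 2-acyclic Cayley group, a chordless path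
`(∅,[v_1]_∅), (α_1,[v_2]_{α_1}), …, (α_ℓ,[v_{ℓ+1}]_{α_ℓ}), (∅,[v_{ℓ+1}]_∅)` of length `ℓ+1`
in the Gaifman graph of `d(G)` restricted to `d(V) ∖ t`, `t = ρ(v_{ℓ+1},γ)`, joined via
the hyperedges `⟦v_1⟧, …, ⟦v_{ℓ+1}⟧`, induces the non-`t` coset path
`v_1, α_1, v_2, …, v_ℓ, α_ℓ, v_{ℓ+1}` in `G`. -/
theorem chordless_to_coset {G : Type*} [Group G] (E : Set G) (hC : IsCayley E)
    (h2 : TwoAcyclic E) (ℓ : ℕ) (hℓ : 1 ≤ ℓ)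
    (vs : ℕ → G) (α : ℕ → Set G) (hα : ∀ i, 1 ≤ i → i ≤ ℓ → α i ⊆ E)
    (hne : vs 1 ≠ vs (ℓ + 1)) (γ : Set G) (hγ : γ ⊆ E)
    (hjoin : ∀ i, 1 ≤ i → i ≤ ℓ → vs i ∈ coset (vs (i + 1)) (α i))
    (hdist : ∀ i j, i ≤ ℓ + 1 → j ≤ ℓ + 1 → i ≠ j →
        pathVert ℓ vs α i ≠ pathVert ℓ vs α j)
    (hnott : ∀ i, i ≤ ℓ + 1 → pathVert ℓ vs α i ∉ rho E (vs (ℓ + 1)) γ)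
    (hchordless : ∀ (w : G) (i j : ℕ), i ≤ ℓ + 1 → j ≤ ℓ + 1 → i + 1 < j →
        ¬ (pathVert ℓ vs α i ∈ dedge E w ∧ pathVert ℓ vs α j ∈ dedge E w)) :
    IsNonTPath E (vs (ℓ + 1)) γ ℓ vs α := by
  refine ⟨⟨hℓ, hα, ?_, fun i h1 hi => mem_coset_comm.mp (hjoin i h1 hi), ?_⟩, ?_⟩
  · intro i j h1 hij hj heq
    obtain ⟨k, rfl⟩ : ∃ k, i = k + 1 := ⟨i - 1, by omega⟩
    exact absurd ⟨pathVert_mem_dedge_of_mem_next hα (by omega) (mem_coset_self _ _),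
      pathVert_mem_dedge_of_mem hα hjoin (by omega) hj (heq ▸ mem_coset_self _ _)⟩
      (hchordless (vs (k + 1)) k j (by omega) hj (by omega))
  · intro i h1 hi
    obtain ⟨k, rfl⟩ : ∃ k, i = k + 1 := ⟨i - 1, by omega⟩
    refine Set.eq_empty_of_forall_notMem fun x hx => ?_
    exact hchordless x k (k + 1 + 1) (by omega) (by omega) (by omega)
      ⟨pathVert_mem_dedge_of_mem_next hα (by omega) (coset_mono _ Set.inter_subset_left hx.1),
        pathVert_mem_dedge_of_mem hα hjoin (by omega) (by omega)
          (coset_mono _ Set.inter_subset_right hx.2)⟩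
  · intro i h1 hi hsub
    have hlast := hsub (mem_coset_self _ _)
    obtain rfl : i = ℓ := by
      by_contra hne'
      refine hchordless (vs (ℓ + 1)) i (ℓ + 1) (by omega) le_rfl (by omega)
        ⟨pathVert_mem_dedge_of_mem hα hjoin h1 (by omega) ?_,
          pathVert_mem_dedge_of_mem hα hjoin (by omega) le_rfl (mem_coset_self _ _)⟩
      rwa [extLabel_of_mem h1 hi]
    refine hnott i (by omega) ?_
    rw [pathVert_eq_next le_rfl, extLabel_of_mem h1 le_rfl]
    refine ⟨fun e he => ?_, hα i h1 le_rfl, rfl⟩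
    refine h2.mem_of_mem_closure (hγ he) (hC.1 e (hγ he)).1 (hα i h1 le_rfl) ?_
    rw [coset_eq_of_mem hlast] at hsub
    have hmem : vs (i + 1) * e ∈ coset (vs (i + 1)) γ := by
      simpa [coset] using Subgroup.subset_closure he
    simpa [coset] using hsub hmem
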